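/- Let K be a field, α ∈ K((T⁻¹)) with partial quotients a_n and continuants (p_n, q_n), let A, B ∈ K[T] be coprime non-zero polynomials, and let β = (A/B)·α, with partial quotients b_m and continuants (u_m, v_m). For each n set A_n = gcd(A, q_n) and B_n = gcd(B, p_n). If the partial quotient a_{n+1} exists and deg a_{n+1} > deg A + deg B − 2·deg A_n − 2·deg B_n, then there exist m ∈ ℕ and k ∈ K \ {0} such that u_m = k·(A/(A_n B_n))·p_n and v_m = k·(B/(A_n B_n))·q_n, and in this case deg b_{m+1} = deg a_{n+1} − deg A − deg B + 2·deg A_n + 2·deg B_n. -/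

import Mathlib

noncomputable section

namespace PaperCF

variable {K : Type*} [Field K]

/-- The element `T` of `K((T⁻¹))`, where `K((T⁻¹))` is modeled as the field
`LaurentSeries K` of Laurent series in the variable `t = T⁻¹`. -/
def Tvar (K : Type*) [Field K] : LaurentSeries K := (HahnSeries.single (-1 : ℤ) (1 : K))

/-- The embedding of `K[T]` into `K((T⁻¹))`, sending the polynomial variable to `T = t⁻¹`. -/
def emb : Polynomial K →+* LaurentSeries K := (Polynomial.aeval (Tvar K)).toRingHom

/-- The polynomial part `⌊α⌋` of a formal Laurent series `α ∈ K((T⁻¹))`. -/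
def polyPart (α : LaurentSeries K) : Polynomial K :=
  ∑ i ∈ Finset.range ((-α.order).toNat + 1), Polynomial.monomial i (α.coeff (-(i : ℤ)))

/-- The complete quotients `αₙ` of the regular continued fraction expansion of `α`
(with the convention `0⁻¹ = 0`, so that `cq α n = 0` for all `n` past the end of a
finite expansion). -/
def cq (α : LaurentSeries K) : ℕ → LaurentSeries K
  | 0 => α
  | n + 1 => (cq α n - emb (polyPart (cq α n)))⁻¹

/-- The partial quotients `aₙ = ⌊αₙ⌋` of the regular continued fraction expansion of `α`. -/
def pq (α : LaurentSeries K) (n : ℕ) : Polynomial K := polyPart (cq α n)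

/-- The continuants `(pₙ, qₙ)` of the regular continued fraction expansion of `α`. -/
def cont (α : LaurentSeries K) : ℕ → Polynomial K × Polynomial K
  | 0 => (pq α 0, 1)
  | 1 => (pq α 1 * pq α 0 + 1, pq α 1)
  | n + 2 => (pq α (n + 2) * (cont α (n + 1)).1 + (cont α n).1,
              pq α (n + 2) * (cont α (n + 1)).2 + (cont α n).2)

/-- `pₙ`. -/
def contP (α : LaurentSeries K) (n : ℕ) : Polynomial K := (cont α n).1

/-- `qₙ`. -/
def contQ (α : LaurentSeries K) (n : ℕ) : Polynomial K := (cont α n).2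

/-- The `n`-th partial quotient (and hence the `n`-th convergent) of `α` genuinely exists. -/
def ConvAt (α : LaurentSeries K) (n : ℕ) : Prop := n = 0 ∨ cq α n ≠ 0

/-- `K(α) = sup_{n ≥ 1} deg aₙ`, as an extended natural number. -/
def KK (α : LaurentSeries K) : ℕ∞ :=
  ⨆ n : {n : ℕ // 1 ≤ n ∧ cq α n ≠ 0}, ((pq α n.1).natDegree : ℕ∞)

/-- `ōK(α) = limsup_n deg aₙ`. -/
def KKbar (α : LaurentSeries K) : ℕ∞ :=
  Filter.limsup (fun n => ((pq α n).natDegree : ℕ∞)) Filter.atTop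

/-- `α` is a rational function, i.e. an element of `K(T) ⊆ K((T⁻¹))`. -/
def IsRat (α : LaurentSeries K) : Prop :=
  ∃ p q : Polynomial K, q ≠ 0 ∧ α * emb q = emb p

/-- Two Laurent series are equivalent if they differ by a Möbius transformation with
matrix in `GL₂(K[T])`. -/
def MEquiv (α β : LaurentSeries K) : Prop :=
  ∃ a b c d : Polynomial K, IsUnit (a * d - b * c) ∧
    emb c * α + emb d ≠ 0 ∧ β = (emb a * α + emb b) / (emb c * α + emb d)

end PaperCF

namespace PaperCF

section

variable {K : Type*} [Field K]

theorem order_add_of_order_lt {x y : LaurentSeries K} (hx : x ≠ 0)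
    (h : y ≠ 0 → x.order < y.order) : x + y ≠ 0 ∧ (x + y).order = x.order := by
  have hlt : x.orderTop < y.orderTop := by
    rw [← HahnSeries.order_eq_orderTop_of_ne_zero hx]
    by_cases hy : y = 0
    · simp [hy]
    · rw [← HahnSeries.order_eq_orderTop_of_ne_zero hy]
      exact_mod_cast h hy
  have htop := HahnSeries.orderTop_add_eq_left hlt
  have hne : x + y ≠ 0 := by
    rw [← HahnSeries.orderTop_ne_top, htop]
    exact HahnSeries.orderTop_ne_top.2 hx
  refine ⟨hne, ?_⟩
  rw [← HahnSeries.order_eq_orderTop_of_ne_zero hne,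
    ← HahnSeries.order_eq_orderTop_of_ne_zero hx] at htop
  exact_mod_cast htop

theorem order_inv {x : LaurentSeries K} (hx : x ≠ 0) : x⁻¹.order = -x.order := by
  have h := HahnSeries.order_mul hx (inv_ne_zero hx)
  rw [mul_inv_cancel₀ hx, HahnSeries.order_one] at h
  lia

theorem emb_monomial (n : ℕ) (a : K) :
    emb (Polynomial.monomial n a) = HahnSeries.single (-(n : ℤ)) a := by
  have h : algebraMap K (LaurentSeries K) a = HahnSeries.single 0 a := by
    rw [HahnSeries.algebraMap_apply']
    simp [HahnSeries.ofPowerSeries_C, HahnSeries.C_apply]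
  simp [emb, Tvar, Polynomial.aeval_monomial, HahnSeries.single_pow, h]

theorem emb_coeff_neg (p : Polynomial K) (n : ℕ) : (emb p).coeff (-(n : ℤ)) = p.coeff n := by
  induction p using Polynomial.induction_on' with
  | add p q hp hq => simp [hp, hq]
  | monomial m a =>
    rw [emb_monomial, HahnSeries.coeff_single, Polynomial.coeff_monomial]
    simp [eq_comm]

theorem emb_coeff_of_pos (p : Polynomial K) {i : ℤ} (hi : 0 < i) : (emb p).coeff i = 0 := by
  induction p using Polynomial.induction_on' with
  | add p q hp hq => simp [hp, hq]
  | monomial m a =>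
    rw [emb_monomial]
    exact HahnSeries.coeff_single_of_ne (by lia)

theorem emb_injective : Function.Injective (emb : Polynomial K → LaurentSeries K) := by
  intro p q h
  ext n
  rw [← emb_coeff_neg, ← emb_coeff_neg, h]

theorem emb_ne_zero {p : Polynomial K} (hp : p ≠ 0) : emb p ≠ 0 :=
  (map_ne_zero_iff _ emb_injective).2 hp

theorem order_emb {p : Polynomial K} (hp : p ≠ 0) : (emb p).order = -(p.natDegree : ℤ) := by
  refine le_antisymm (HahnSeries.order_le_of_coeff_ne_zero ?_)
    ((HahnSeries.le_order_iff_forall (emb_ne_zero hp)).2 fun j hj => ?_)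
  · rwa [emb_coeff_neg, Polynomial.coeff_natDegree, Polynomial.leadingCoeff_ne_zero]
  · obtain ⟨k, rfl⟩ : ∃ k : ℕ, j = -(k : ℤ) := ⟨j.natAbs, by lia⟩
    rw [emb_coeff_neg]
    exact Polynomial.coeff_eq_zero_of_natDegree_lt (by lia)

theorem polyPart_coeff (x : LaurentSeries K) (n : ℕ) :
    (polyPart x).coeff n = x.coeff (-(n : ℤ)) := by
  simp only [polyPart, Polynomial.finsetSum_coeff, Polynomial.coeff_monomial,
    Finset.sum_ite_eq', Finset.mem_range]
  split_ifs with h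
  · rfl
  · exact (HahnSeries.coeff_eq_zero_of_lt_order (by lia)).symm

theorem polyPart_zero : polyPart (0 : LaurentSeries K) = 0 := by
  ext n
  simp [polyPart_coeff]

theorem order_sub_polyPart_pos {x : LaurentSeries K} (h : x - emb (polyPart x) ≠ 0) :
    0 < (x - emb (polyPart x)).order := by
  refine Int.lt_of_add_one_le ((HahnSeries.le_order_iff_forall h).2 fun j hj => ?_)
  obtain ⟨k, rfl⟩ : ∃ k : ℕ, j = -(k : ℤ) := ⟨j.natAbs, by lia⟩
  rw [HahnSeries.coeff_sub, emb_coeff_neg, polyPart_coeff, sub_self]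

theorem polyPart_eq_of_order_pos {x : LaurentSeries K} {p : Polynomial K}
    (h : 0 < (x - emb p).order) : polyPart x = p := by
  ext n
  rw [polyPart_coeff, ← emb_coeff_neg, ← sub_eq_zero, ← HahnSeries.coeff_sub]
  exact HahnSeries.coeff_eq_zero_of_lt_order (by lia)

theorem natDegree_polyPart {x : LaurentSeries K} (hx : x ≠ 0) (h : x.order ≤ 0) :
    ((polyPart x).natDegree : ℤ) = -x.order := by
  have hx' : -(x.order.natAbs : ℤ) = x.order := by lia
  have hdeg : (polyPart x).natDegree = x.order.natAbs := by
    refine Polynomial.natDegree_eq_of_le_of_coeff_ne_zero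
      (Polynomial.natDegree_le_iff_coeff_eq_zero.2 fun n hn => ?_) ?_
    · rw [polyPart_coeff]
      exact HahnSeries.coeff_eq_zero_of_lt_order (by lia)
    · rw [polyPart_coeff, hx']
      exact HahnSeries.coeff_order_eq_zero.not.2 hx
  lia

theorem cq_one_order_neg {x : LaurentSeries K} (h : cq x 1 ≠ 0) : (cq x 1).order < 0 := by
  have h0 : x - emb (polyPart x) ≠ 0 := fun h' => h (inv_eq_zero.2 h')
  have := order_sub_polyPart_pos h0
  change (x - emb (polyPart x))⁻¹.order < 0
  rw [order_inv h0]
  lia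

theorem cq_zero_left (n : ℕ) : cq (0 : LaurentSeries K) n = 0 := by
  induction n with
  | zero => rfl
  | succ n ih => simp [cq, ih, polyPart_zero]

theorem cq_succ' (x : LaurentSeries K) (n : ℕ) : cq x (n + 1) = cq (cq x 1) n := by
  induction n with
  | zero => rfl
  | succ n ih => rw [cq, ih, ← cq]

theorem pq_succ' (x : LaurentSeries K) (n : ℕ) : pq x (n + 1) = pq (cq x 1) n := by
  rw [pq, cq_succ', ← pq]

theorem cont_succ' (x : LaurentSeries K) (n : ℕ) :
    cont x (n + 1) =
      (pq x 0 * contP (cq x 1) n + contQ (cq x 1) n, contP (cq x 1) n) := by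
  simp only [contP, contQ]
  induction n using Nat.twoStepInduction with
  | zero => simp [cont, pq_succ', mul_comm]
  | one =>
    simp only [cont, pq_succ', Prod.mk.injEq, and_true]
    ring
  | more n h₁ h₂ =>
    rw [cont, h₁, h₂, pq_succ', cont]
    simp only [Prod.mk.injEq, and_true]
    ring

theorem contP_succ' (x : LaurentSeries K) (n : ℕ) :
    contP x (n + 1) = pq x 0 * contP (cq x 1) n + contQ (cq x 1) n := by
  rw [contP, cont_succ']

theorem contQ_succ' (x : LaurentSeries K) (n : ℕ) : contQ x (n + 1) = contP (cq x 1) n := by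
  rw [contQ, cont_succ']

theorem isCoprime_cont (x : LaurentSeries K) (n : ℕ) : IsCoprime (contP x n) (contQ x n) := by
  induction n generalizing x with
  | zero => exact isCoprime_one_right
  | succ n ih =>
    rw [contP_succ', contQ_succ', add_comm, mul_comm]
    exact (ih _).symm.add_mul_left_left _

/-- The error of approximation of a convergent which is not the last one. -/
theorem order_contQ_mul_sub_contP {x : LaurentSeries K} {n : ℕ} (h : cq x (n + 1) ≠ 0) :
    contQ x n ≠ 0 ∧ emb (contQ x n) * x - emb (contP x n) ≠ 0 ∧
      (emb (contQ x n) * x - emb (contP x n)).order =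
        (contQ x n).natDegree + (pq x (n + 1)).natDegree := by
  induction n generalizing x with
  | zero =>
    have h0 : x - emb (polyPart x) ≠ 0 := fun h' => h (inv_eq_zero.2 h')
    have hpq := natDegree_polyPart h (cq_one_order_neg h).le
    have hinv : (cq x 1).order = -(x - emb (polyPart x)).order := order_inv h0
    simp only [contQ, contP, cont, pq, cq, map_one, one_mul, zero_add, Polynomial.natDegree_one,
      Nat.cast_zero] at *
    exact ⟨one_ne_zero, h0, by lia⟩
  | succ n ih =>
    have h1 : cq x 1 ≠ 0 := by
      intro h1
      rw [cq_succ', h1, cq_zero_left] at h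
      exact h rfl
    have hneg := cq_one_order_neg h1
    rw [cq_succ'] at h
    obtain ⟨hQ, hne, hord⟩ := ih h
    rw [contQ_succ', contP_succ', pq_succ']
    set y := cq x 1 with hy
    have hx : x = emb (pq x 0) + y⁻¹ := by simp [hy, cq, pq]
    have hQy : emb (contQ y n) * y ≠ 0 := mul_ne_zero (emb_ne_zero hQ) h1
    have hQyord : (emb (contQ y n) * y).order = -((contQ y n).natDegree : ℤ) + y.order := by
      rw [HahnSeries.order_mul (emb_ne_zero hQ) h1, order_emb hQ]
    obtain ⟨hP, hPord⟩ := order_add_of_order_lt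
      (y := -(emb (contQ y n) * y - emb (contP y n))) hQy
      (fun _ => by rw [HahnSeries.order_neg]; lia)
    rw [show emb (contQ y n) * y + -(emb (contQ y n) * y - emb (contP y n)) = emb (contP y n) by
      ring] at hP hPord
    have hP' : contP y n ≠ 0 := fun h0 => hP (by rw [h0, map_zero])
    rw [order_emb hP'] at hPord
    have herr : emb (contP y n) * x - emb (pq x 0 * contP y n + contQ y n) =
        -(emb (contQ y n) * y - emb (contP y n)) * y⁻¹ := by
      nth_rw 1 [hx]
      simp only [map_add, map_mul]
      field_simp
      ring
    rw [herr]
    refine ⟨hP', mul_ne_zero (neg_ne_zero.2 hne) (inv_ne_zero h1), ?_⟩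
    rw [HahnSeries.order_mul (neg_ne_zero.2 hne) (inv_ne_zero h1), HahnSeries.order_neg,
      order_inv h1]
    lia

/-- Legendre's criterion: a reduced fraction `U / V` that approximates `x` well enough is a
convergent of `x`, and the quality of approximation gives the degree of the next partial
quotient. -/
theorem exists_cont_eq_of_order {x : LaurentSeries K} {U V : Polynomial K} {d : ℕ} (hV : V ≠ 0)
    (hUV : IsCoprime U V) (hd : 0 < d) (hne : emb V * x - emb U ≠ 0)
    (hord : (emb V * x - emb U).order = V.natDegree + d) :
    ∃ (m : ℕ) (k : K), k ≠ 0 ∧ contP x m = Polynomial.C k * U ∧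
      contQ x m = Polynomial.C k * V ∧ (pq x (m + 1)).natDegree = d := by
  induction hN : V.natDegree using Nat.strong_induction_on generalizing x U V with
  | _ N ih =>
  subst hN
  rcases Nat.eq_zero_or_pos V.natDegree with hV0 | hVpos
  · obtain ⟨c, rfl⟩ := Polynomial.natDegree_eq_zero.1 hV0
    have hc : c ≠ 0 := by simpa using hV
    have hcc : Polynomial.C c⁻¹ * Polynomial.C c = 1 := by
      rw [← Polynomial.C_mul, inv_mul_cancel₀ hc, Polynomial.C_1]
    have hci : Polynomial.C c⁻¹ ≠ 0 := by simpa using hc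
    have herr : x - emb (Polynomial.C c⁻¹ * U) =
        emb (Polynomial.C c⁻¹) * (emb (Polynomial.C c) * x - emb U) := by
      rw [mul_sub, ← mul_assoc, ← map_mul, hcc, map_one, one_mul, map_mul]
    have hne' : x - emb (Polynomial.C c⁻¹ * U) ≠ 0 :=
      herr ▸ mul_ne_zero (emb_ne_zero hci) hne
    have hord' : (x - emb (Polynomial.C c⁻¹ * U)).order = d := by
      rw [herr, HahnSeries.order_mul (emb_ne_zero hci) hne, order_emb hci, hord]
      simp
    have hpoly : polyPart x = Polynomial.C c⁻¹ * U :=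
      polyPart_eq_of_order_pos (by lia)
    have hcq : cq x 1 = (x - emb (Polynomial.C c⁻¹ * U))⁻¹ := by simp [cq, hpoly]
    have hcqord : (cq x 1).order = -d := by rw [hcq, order_inv hne', hord']
    refine ⟨0, c⁻¹, inv_ne_zero hc, hpoly, hcc.symm, ?_⟩
    have := natDegree_polyPart (hcq ▸ inv_ne_zero hne') (by lia : (cq x 1).order ≤ 0)
    rw [zero_add, pq]
    lia
  · set W := U - pq x 0 * V with hW
    have hVW : IsCoprime V W := by
      have := (hUV.add_mul_right_left (-pq x 0)).symm
      rwa [neg_mul, ← sub_eq_add_neg] at this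
    have hW0 : W ≠ 0 := by
      intro h0
      rw [h0, isCoprime_zero_right] at hVW
      exact hVpos.ne' (Polynomial.natDegree_eq_zero_of_isUnit hVW)
    have hWord := order_emb hW0
    have hfrac := (order_add_of_order_lt (x := emb W) (y := emb V * x - emb U)
      (emb_ne_zero hW0) (fun _ => by lia))
    have hsum : emb W + (emb V * x - emb U) = emb V * (x - emb (polyPart x)) := by
      simp only [hW, pq, cq, map_sub, map_mul]
      ring
    rw [hsum] at hfrac
    have hx0 : x - emb (polyPart x) ≠ 0 := right_ne_zero_of_mul hfrac.1
    have hxpos := order_sub_polyPart_pos hx0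
    rw [HahnSeries.order_mul (emb_ne_zero hV) hx0, order_emb hV, hWord] at hfrac
    have hy0 : cq x 1 ≠ 0 := inv_ne_zero hx0
    have hyord : (cq x 1).order = -(x - emb (polyPart x)).order := order_inv hx0
    have herr : emb W * cq x 1 - emb V = -(emb V * x - emb U) * cq x 1 := by
      have hinv : (x - emb (polyPart x)) * cq x 1 = 1 := mul_inv_cancel₀ hx0
      linear_combination cq x 1 * hsum + emb V * hinv
    have hnexerr := neg_ne_zero.2 hne
    obtain ⟨m, k, hk, hP, hQ, hdeg⟩ := ih W.natDegree (by lia) hW0 hVW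
      (herr ▸ mul_ne_zero hnexerr hy0)
      (by rw [herr, HahnSeries.order_mul hnexerr hy0, HahnSeries.order_neg]; lia) rfl
    refine ⟨m + 1, k, hk, ?_, ?_, ?_⟩
    · rw [contP_succ', hP, hQ, hW]
      ring
    · rw [contQ_succ', hP]
    · rw [pq_succ', hdeg]

end

end PaperCF

open PaperCF in
/-- Behaviour of continuants under multiplication by a rational function
`A/B`: if `deg a_{n+1} > deg A + deg B − 2 deg Aₙ − 2 deg Bₙ` with `Aₙ = gcd(A, qₙ)` and
`Bₙ = gcd(B, pₙ)`, then `(A pₙ/(AₙBₙ), B qₙ/(AₙBₙ))` is, up to a constant, a continuant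
`(uₘ, vₘ)` of `β = (A/B)α`, and `deg b_{m+1} = deg a_{n+1} − deg A − deg B + 2 deg Aₙ +
2 deg Bₙ`.  (The equalities for `uₘ, vₘ` are stated multiplied through by `AₙBₙ`.) -/
theorem continuants_of_mul_rational {K : Type*} [Field K] [DecidableEq K]
    (α : LaurentSeries K) (A B : Polynomial K) (hA : A ≠ 0) (hB : B ≠ 0)
    (hAB : IsCoprime A B) (n : ℕ) (hex : cq α (n + 1) ≠ 0)
    (hdeg : (A.natDegree : ℤ) + (B.natDegree : ℤ)
        - 2 * ((EuclideanDomain.gcd A (contQ α n)).natDegree : ℤ)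
        - 2 * ((EuclideanDomain.gcd B (contP α n)).natDegree : ℤ)
        < ((pq α (n + 1)).natDegree : ℤ)) :
    ∃ (m : ℕ) (k : K), k ≠ 0 ∧
      contP (emb A / emb B * α) m *
          (EuclideanDomain.gcd A (contQ α n) * EuclideanDomain.gcd B (contP α n)) =
        Polynomial.C k * A * contP α n ∧
      contQ (emb A / emb B * α) m *
          (EuclideanDomain.gcd A (contQ α n) * EuclideanDomain.gcd B (contP α n)) =
        Polynomial.C k * B * contQ α n ∧
      ((pq (emb A / emb B * α) (m + 1)).natDegree : ℤ)
        = ((pq α (n + 1)).natDegree : ℤ) - (A.natDegree : ℤ) - (B.natDegree : ℤ)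
          + 2 * ((EuclideanDomain.gcd A (contQ α n)).natDegree : ℤ)
          + 2 * ((EuclideanDomain.gcd B (contP α n)).natDegree : ℤ) := by
  obtain ⟨hq, hne, hord⟩ := order_contQ_mul_sub_contP hex
  have hcop := isCoprime_cont α n
  set p := contP α n
  set q := contQ α n
  set g := EuclideanDomain.gcd A q
  set h := EuclideanDomain.gcd B p
  have hg0 : g ≠ 0 := fun h0 => hA (EuclideanDomain.gcd_eq_zero_iff.1 h0).1
  have hh0 : h ≠ 0 := fun h0 => hB (EuclideanDomain.gcd_eq_zero_iff.1 h0).1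
  obtain ⟨A', hA'⟩ : g ∣ A := EuclideanDomain.gcd_dvd_left A q
  obtain ⟨q', hq'⟩ : g ∣ q := EuclideanDomain.gcd_dvd_right A q
  obtain ⟨B', hB'⟩ : h ∣ B := EuclideanDomain.gcd_dvd_left B p
  obtain ⟨p', hp'⟩ : h ∣ p := EuclideanDomain.gcd_dvd_right B p
  have hAq : IsCoprime A' q' := by
    refine ⟨EuclideanDomain.gcdA A q, EuclideanDomain.gcdB A q, mul_left_cancel₀ hg0 ?_⟩
    linear_combination -EuclideanDomain.gcd_eq_gcd_ab A q -
      EuclideanDomain.gcdA A q * hA' - EuclideanDomain.gcdB A q * hq'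
  have hBp : IsCoprime B' p' := by
    refine ⟨EuclideanDomain.gcdA B p, EuclideanDomain.gcdB B p, mul_left_cancel₀ hh0 ?_⟩
    linear_combination -EuclideanDomain.gcd_eq_gcd_ab B p -
      EuclideanDomain.gcdA B p * hB' - EuclideanDomain.gcdB B p * hp'
  have hA'0 : A' ≠ 0 := by rintro rfl; simp [hA'] at hA
  have hB'0 : B' ≠ 0 := by rintro rfl; simp [hB'] at hB
  have hq'0 : q' ≠ 0 := by intro h0; simp [hq', h0] at hq
  have hAdeg : A.natDegree = g.natDegree + A'.natDegree := by
    conv_lhs => rw [hA', Polynomial.natDegree_mul hg0 hA'0]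
  have hBdeg : B.natDegree = h.natDegree + B'.natDegree := by
    conv_lhs => rw [hB', Polynomial.natDegree_mul hh0 hB'0]
  have hqdeg : q.natDegree = g.natDegree + q'.natDegree := by
    conv_lhs => rw [hq', Polynomial.natDegree_mul hg0 hq'0]
  have hVdeg := Polynomial.natDegree_mul hB'0 hq'0
  have hUV : IsCoprime (A' * p') (B' * q') := by
    have hAB' : IsCoprime A' B' :=
      (hAB.of_isCoprime_of_dvd_left ⟨g, by rw [mul_comm]; exact hA'⟩).of_isCoprime_of_dvd_right
        ⟨h, by rw [mul_comm]; exact hB'⟩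
    have hpq' : IsCoprime p' q' :=
      (hcop.of_isCoprime_of_dvd_left ⟨h, by rw [mul_comm]; exact hp'⟩).of_isCoprime_of_dvd_right
        ⟨g, by rw [mul_comm]; exact hq'⟩
    exact (hAB'.mul_right hAq).mul_left (hBp.symm.mul_right hpq')
  have heh := emb_ne_zero hh0
  have heA' := emb_ne_zero hA'0
  have herr : emb h * (emb (B' * q') * (emb A / emb B * α) - emb (A' * p')) =
      emb A' * (emb q * α - emb p) := by
    have heB' := emb_ne_zero hB'0
    have hAe := congrArg emb hA'
    have hBe := congrArg emb hB'
    have hqe := congrArg emb hq'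
    have hpe := congrArg emb hp'
    simp only [map_mul] at hAe hBe hqe hpe ⊢
    rw [hAe, hBe, hqe, hpe]
    field_simp
  have hrhs : emb A' * (emb q * α - emb p) ≠ 0 := mul_ne_zero heA' hne
  have hlhs := right_ne_zero_of_mul (herr ▸ hrhs)
  have herrord := congrArg HahnSeries.order herr
  rw [HahnSeries.order_mul heh hlhs, HahnSeries.order_mul heA' hne, hord, order_emb hh0,
    order_emb hA'0] at herrord
  obtain ⟨d, hd⟩ : ∃ d : ℕ, (d : ℤ) = ((pq α (n + 1)).natDegree : ℤ) - A.natDegree -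
      B.natDegree + 2 * g.natDegree + 2 * h.natDegree :=
    ⟨_, Int.toNat_of_nonneg (by lia)⟩
  obtain ⟨m, k, hk, hP, hQ, hdegm⟩ := exists_cont_eq_of_order (d := d) (mul_ne_zero hB'0 hq'0)
    hUV (by lia) hlhs (by lia)
  refine ⟨m, k, hk, ?_, ?_, by rw [hdegm, hd]⟩
  · rw [hP]
    linear_combination -Polynomial.C k * p * hA' - Polynomial.C k * (g * A') * hp'
  · rw [hQ]
    linear_combination -Polynomial.C k * q * hB' - Polynomial.C k * (h * B') * hq'
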